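/- For every even integer k with k > 2, every odd integer u with u > 1 such that u divides k, and every integer m with m ≥ k + u, there exists a k-homogeneous Latin bitrade of volume k·m. -/

import Mathlib

/-- A partial Latin square: a finite set of (row, column, entry) triples such that
no two distinct triples agree in (row, column), in (row, entry), or in (column, entry). -/
def IsPartialLatinSquare (T : Finset (ℕ × ℕ × ℕ)) : Prop :=
  (∀ x ∈ T, ∀ y ∈ T, x.1 = y.1 → x.2.1 = y.2.1 → x = y) ∧
  (∀ x ∈ T, ∀ y ∈ T, x.1 = y.1 → x.2.2 = y.2.2 → x = y) ∧
  (∀ x ∈ T, ∀ y ∈ T, x.2.1 = y.2.1 → x.2.2 = y.2.2 → x = y)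

/-- A Latin bitrade: a pair of disjoint partial Latin squares with the same filled
cells, the same entry set in each row, and the same entry set in each column. -/
def IsLatinBitrade (T T' : Finset (ℕ × ℕ × ℕ)) : Prop :=
  IsPartialLatinSquare T ∧ IsPartialLatinSquare T' ∧
  Disjoint T T' ∧
  (∀ r c, (∃ e, (r, c, e) ∈ T) ↔ (∃ e, (r, c, e) ∈ T')) ∧
  (∀ r e, (∃ c, (r, c, e) ∈ T) ↔ (∃ c, (r, c, e) ∈ T')) ∧
  (∀ c e, (∃ r, (r, c, e) ∈ T) ↔ (∃ r, (r, c, e) ∈ T'))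

/-- A Latin bitrade is k-homogeneous if each nonempty row and column of T contains
exactly k filled cells, and each entry value occurring in T occurs exactly k times. -/
def IsHomogeneousLatinBitrade (k : ℕ) (T T' : Finset (ℕ × ℕ × ℕ)) : Prop :=
  IsLatinBitrade T T' ∧
  (∀ r, (∃ x ∈ T, x.1 = r) → (T.filter (fun x => x.1 = r)).card = k) ∧
  (∀ c, (∃ x ∈ T, x.2.1 = c) → (T.filter (fun x => x.2.1 = c)).card = k) ∧
  (∀ e, (∃ x ∈ T, x.2.2 = e) → (T.filter (fun x => x.2.2 = e)).card = k)

/-- A Latin bitrade (T, T') is primary if every nonempty Latin bitrade (U, U') with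
U ⊆ T and U' ⊆ T' satisfies U = T and U' = T'. -/
def IsPrimaryLatinBitrade (T T' : Finset (ℕ × ℕ × ℕ)) : Prop :=
  IsLatinBitrade T T' ∧
  ∀ U U' : Finset (ℕ × ℕ × ℕ), IsLatinBitrade U U' → U.Nonempty →
    U ⊆ T → U' ⊆ T' → U = T ∧ U' = T'

/-- The cyclic array with base row `(α i, β i)`. -/
def cycT {ι : Type} [Fintype ι] {m : ℕ} [NeZero m] (α β : ι → ZMod m) : Finset (ℕ × ℕ × ℕ) :=
  (Finset.univ : Finset (ZMod m × ι)).image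
    (fun p => (p.1.val, (p.1 + α p.2).val, (p.1 + β p.2).val))

section cyc
variable {ι : Type} [Fintype ι] {m : ℕ} [NeZero m]

lemma mem_cycT (α β : ι → ZMod m) (t : ℕ × ℕ × ℕ) :
    t ∈ cycT α β ↔ ∃ x i, ((x : ZMod m).val, (x + α i).val, (x + β i).val) = t := by
  simp [cycT]

lemma cycT_pls (α β : ι → ZMod m) (hα : Function.Injective α) (hβ : Function.Injective β)
    (hd : Function.Injective (fun i => β i - α i)) : IsPartialLatinSquare (cycT α β) := by
  have vi := ZMod.val_injective m
  refine ⟨?_, ?_, ?_⟩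
  · intro s hs t ht h1 h2
    obtain ⟨x, i, rfl⟩ := (mem_cycT _ _ _).1 hs
    obtain ⟨y, j, rfl⟩ := (mem_cycT _ _ _).1 ht
    have h1 := vi h1
    have h2 := vi h2
    subst h1
    have := hα (add_left_cancel h2)
    subst this; rfl
  · intro s hs t ht h1 h2
    obtain ⟨x, i, rfl⟩ := (mem_cycT _ _ _).1 hs
    obtain ⟨y, j, rfl⟩ := (mem_cycT _ _ _).1 ht
    have h1 := vi h1
    have h2 := vi h2
    subst h1
    have := hβ (add_left_cancel h2)
    subst this; rfl
  · intro s hs t ht h1 h2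
    obtain ⟨x, i, rfl⟩ := (mem_cycT _ _ _).1 hs
    obtain ⟨y, j, rfl⟩ := (mem_cycT _ _ _).1 ht
    have h1 := vi h1
    have h2 := vi h2
    have h3 : i = j := hd (by simp only; linear_combination h2 - h1)
    subst h3
    have := add_right_cancel h1
    subst this; rfl

lemma cycT_card (α β : ι → ZMod m) (hα : Function.Injective α) :
    (cycT α β).card = Fintype.card ι * m := by
  have vi := ZMod.val_injective m
  rw [cycT, Finset.card_image_of_injective]
  · simp [ZMod.card, mul_comm]
  · rintro ⟨x, i⟩ ⟨y, j⟩ h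
    simp only [Prod.mk.injEq] at h
    have h1 := vi h.1
    have h2 := vi h.2.1
    subst h1
    rw [hα (add_left_cancel h2)]

lemma cycT_row (α β : ι → ZMod m) (hα : Function.Injective α) (r : ℕ)
    (hr : ∃ x ∈ cycT α β, x.1 = r) :
    ((cycT α β).filter (fun x => x.1 = r)).card = Fintype.card ι := by
  have vi := ZMod.val_injective m
  obtain ⟨t, ht, rfl⟩ := hr
  obtain ⟨x, i, rfl⟩ := (mem_cycT _ _ _).1 ht
  rw [← Finset.card_univ, ← Finset.card_image_of_injective Finset.univ
    (f := fun j => (x.val, (x + α j).val, (x + β j).val))]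
  · congr 1
    ext s
    simp only [Finset.mem_filter, mem_cycT, Finset.mem_image, Finset.mem_univ, true_and]
    constructor
    · rintro ⟨⟨y, j, rfl⟩, h⟩
      have h := vi h
      subst h
      exact ⟨j, rfl⟩
    · rintro ⟨j, rfl⟩
      exact ⟨⟨x, j, rfl⟩, rfl⟩
  · intro a b h
    simp only [Prod.mk.injEq] at h
    exact hα (add_left_cancel (vi h.2.1))

lemma cycT_col (α β : ι → ZMod m) (hα : Function.Injective α) (r : ℕ)
    (hr : ∃ x ∈ cycT α β, x.2.1 = r) :
    ((cycT α β).filter (fun x => x.2.1 = r)).card = Fintype.card ι := by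
  have vi := ZMod.val_injective m
  obtain ⟨t, ht, rfl⟩ := hr
  obtain ⟨x, i, rfl⟩ := (mem_cycT _ _ _).1 ht
  rw [← Finset.card_univ, ← Finset.card_image_of_injective Finset.univ
    (f := fun j => ((x + α i - α j).val, (x + α i - α j + α j).val,
      (x + α i - α j + β j).val))]
  · congr 1
    ext s
    simp only [Finset.mem_filter, mem_cycT, Finset.mem_image, Finset.mem_univ, true_and]
    constructor
    · rintro ⟨⟨y, j, rfl⟩, h⟩
      have h := vi h
      refine ⟨j, ?_⟩
      rw [← h]; simp
    · rintro ⟨j, rfl⟩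
      exact ⟨⟨_, j, rfl⟩, by simp⟩
  · intro a b h
    simp only [Prod.mk.injEq] at h
    exact hα (by linear_combination - vi h.1)

lemma cycT_ent (α β : ι → ZMod m) (hβ : Function.Injective β) (r : ℕ)
    (hr : ∃ x ∈ cycT α β, x.2.2 = r) :
    ((cycT α β).filter (fun x => x.2.2 = r)).card = Fintype.card ι := by
  have vi := ZMod.val_injective m
  obtain ⟨t, ht, rfl⟩ := hr
  obtain ⟨x, i, rfl⟩ := (mem_cycT _ _ _).1 ht
  rw [← Finset.card_univ, ← Finset.card_image_of_injective Finset.univ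
    (f := fun j => ((x + β i - β j).val, (x + β i - β j + α j).val,
      (x + β i - β j + β j).val))]
  · congr 1
    ext s
    simp only [Finset.mem_filter, mem_cycT, Finset.mem_image, Finset.mem_univ, true_and]
    constructor
    · rintro ⟨⟨y, j, rfl⟩, h⟩
      have h := vi h
      refine ⟨j, ?_⟩
      rw [← h]; simp
    · rintro ⟨j, rfl⟩
      exact ⟨⟨_, j, rfl⟩, by simp⟩
  · intro a b h
    simp only [Prod.mk.injEq] at h
    exact hβ (by linear_combination - vi h.1)

lemma cycT_cells (α β β' : ι → ZMod m) (r c : ℕ) (h : ∃ e, (r, c, e) ∈ cycT α β) :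
    ∃ e, (r, c, e) ∈ cycT α β' := by
  obtain ⟨e, he⟩ := h
  obtain ⟨x, i, h⟩ := (mem_cycT _ _ _).1 he
  simp only [Prod.mk.injEq] at h
  obtain ⟨rfl, rfl, rfl⟩ := h
  exact ⟨_, (mem_cycT _ _ _).2 ⟨x, i, rfl⟩⟩

lemma cycT_rows (α β β' : ι → ZMod m) (hb : ∀ i, ∃ j, β' j = β i) (r e : ℕ)
    (h : ∃ c, (r, c, e) ∈ cycT α β) :
    ∃ c, (r, c, e) ∈ cycT α β' := by
  obtain ⟨c, he⟩ := h
  obtain ⟨x, i, h⟩ := (mem_cycT _ _ _).1 he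
  simp only [Prod.mk.injEq] at h
  obtain ⟨rfl, rfl, rfl⟩ := h
  obtain ⟨j, hj⟩ := hb i
  exact ⟨_, (mem_cycT _ _ _).2 ⟨x, j, by rw [← hj]⟩⟩

lemma cycT_cols (α β β' : ι → ZMod m) (hb : ∀ i, ∃ j, β' j - α j = β i - α i) (c e : ℕ)
    (h : ∃ r, (r, c, e) ∈ cycT α β) :
    ∃ r, (r, c, e) ∈ cycT α β' := by
  obtain ⟨r, he⟩ := h
  obtain ⟨x, i, h⟩ := (mem_cycT _ _ _).1 he
  simp only [Prod.mk.injEq] at h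
  obtain ⟨rfl, rfl, rfl⟩ := h
  obtain ⟨j, hj⟩ := hb i
  refine ⟨(x + α i - α j).val, (mem_cycT _ _ _).2 ⟨x + α i - α j, j, ?_⟩⟩
  have e1 : x + α i - α j + α j = x + α i := by ring
  have e2 : x + α i - α j + β' j = x + β i := by linear_combination hj
  rw [e1, e2]

lemma cycT_bitrade (α β β' : ι → ZMod m) (hα : Function.Injective α)
    (hβ : Function.Injective β) (hβ' : Function.Injective β')
    (hd : Function.Injective (fun i => β i - α i))
    (hd' : Function.Injective (fun i => β' i - α i))
    (hne : ∀ i, β i ≠ β' i)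
    (h1 : ∀ i, ∃ j, β' j = β i) (h2 : ∀ i, ∃ j, β j = β' i)
    (h3 : ∀ i, ∃ j, β' j - α j = β i - α i) (h4 : ∀ i, ∃ j, β j - α j = β' i - α i) :
    IsHomogeneousLatinBitrade (Fintype.card ι) (cycT α β) (cycT α β') := by
  have vi := ZMod.val_injective m
  refine ⟨⟨cycT_pls α β hα hβ hd, cycT_pls α β' hα hβ' hd', ?_,
    fun r c => ⟨cycT_cells _ _ _ r c, cycT_cells _ _ _ r c⟩,
    fun r c => ⟨cycT_rows _ _ _ h1 r c, cycT_rows _ _ _ h2 r c⟩,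
    fun r c => ⟨cycT_cols _ _ _ h3 r c, cycT_cols _ _ _ h4 r c⟩⟩,
    cycT_row α β hα, cycT_col α β hα, cycT_ent α β hβ⟩
  rw [Finset.disjoint_left]
  intro t ht ht'
  obtain ⟨x, i, rfl⟩ := (mem_cycT _ _ _).1 ht
  obtain ⟨y, j, h⟩ := (mem_cycT _ _ _).1 ht'
  simp only [Prod.mk.injEq] at h
  have e1 := vi h.1
  have e2 := vi h.2.1
  have e3 := vi h.2.2
  subst e1
  have := hα (add_left_cancel e2)
  subst this
  exact hne _ (add_left_cancel e3).symm

end cyc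

/-- A permutation of `[0, 2p]` such that `a + zf p a` is a bijection onto `[p, 3p]`. -/
def zf (p a : ℤ) : ℤ := if a ≤ p then 2 * p - 2 * a else 4 * p + 1 - 2 * a

lemma zf_bd (p a : ℤ) (h0 : 0 ≤ a) (h1 : a ≤ 2 * p) : 0 ≤ zf p a ∧ zf p a ≤ 2 * p ∧
    p ≤ a + zf p a ∧ a + zf p a ≤ 3 * p := by
  unfold zf; split_ifs <;> omega

lemma zf_inj (p a b : ℤ) (h : zf p a = zf p b) : a = b := by
  unfold zf at h; split_ifs at h <;> omega

lemma zf_add_inj (p a b : ℤ) (h0 : 0 ≤ a) (h1 : a ≤ 2 * p) (h2 : 0 ≤ b) (h3 : b ≤ 2 * p)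
    (h : a + zf p a = b + zf p b) : a = b := by
  unfold zf at h; split_ifs at h <;> omega

lemma zf_ne (p a : ℤ) (hp : 1 ≤ p) : zf p a ≠ 2 * p - zf p (2 * p - a) := by
  unfold zf; split_ifs <;> omega

lemma comb_inj (u L x y x' y' : ℤ) (hy : L ≤ y) (hy1 : y < L + u) (hy' : L ≤ y')
    (hy1' : y' < L + u) (h : u * x + y = u * x' + y') : x = x' ∧ y = y' := by
  have hd : u ∣ y - y' := ⟨x' - x, by linarith⟩
  have h0 : y - y' = 0 := Int.eq_zero_of_abs_lt_dvd hd (by rw [abs_lt]; constructor <;> linarith)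
  have hu : u ≠ 0 := by intro h; subst h; linarith
  refine ⟨mul_left_cancel₀ hu (by linarith), by linarith⟩

lemma cast_inj_win (m : ℕ) [NeZero m] (L x y : ℤ) (hx : L ≤ x) (hx1 : x < L + m) (hy : L ≤ y)
    (hy1 : y < L + m) (h : (x : ZMod m) = (y : ZMod m)) : x = y := by
  have hd : (m : ℤ) ∣ x - y := by
    apply (ZMod.intCast_zmod_eq_zero_iff_dvd _ m).1
    push_cast; rw [h, sub_self]
  have h0 : x - y = 0 := Int.eq_zero_of_abs_lt_dvd hd (by rw [abs_lt]; constructor <;> linarith)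
  linarith

/-- Injectivity of a two-level combination modulo `m`. -/
lemma cast_comb_inj {p q m : ℕ} [NeZero m] (hm : (2 * p + 1) * (2 * q + 1) ≤ m)
    (F : Fin (2 * p) → ℤ) (G : Fin (2 * q + 1) → ℤ) (A B : ℤ)
    (hF : ∀ j, A ≤ F j ∧ F j ≤ A + 2 * p) (hG : ∀ j, B ≤ G j ∧ G j ≤ B + 2 * q)
    (hFi : Function.Injective F) (hGi : Function.Injective G) :
    Function.Injective (fun t : Fin (2 * p) × Fin (2 * q + 1) =>
      (((2 * q + 1 : ℤ) * F t.1 + G t.2 : ℤ) : ZMod m)) := by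
  have hm' : ((2 * p + 1) * (2 * q + 1) : ℤ) ≤ m := by exact_mod_cast hm
  have win : ∀ j i, (2 * q + 1 : ℤ) * A + B ≤ (2 * q + 1 : ℤ) * F j + G i ∧
      (2 * q + 1 : ℤ) * F j + G i < (2 * q + 1 : ℤ) * A + B + m := by
    intro j i
    have := hF j
    have := hG i
    constructor <;> nlinarith
  rintro ⟨j, i⟩ ⟨j', i'⟩ h
  have h1 := cast_inj_win m _ _ _ (win j i).1 (win j i).2 (win j' i').1 (win j' i').2 h
  have g1 := hG i
  have g2 := hG i'
  obtain ⟨e1, e2⟩ := comb_inj _ B _ _ _ _ g1.1 (by linarith) g2.1 (by linarith) h1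
  rw [hFi e1, hGi e2]

theorem stmt_3 (k u m : ℕ) (hk : Even k) (hk2 : 2 < k)
    (hu : Odd u) (hu1 : 1 < u) (hdvd : u ∣ k) (hm : k + u ≤ m) :
    ∃ T T' : Finset (ℕ × ℕ × ℕ),
      IsHomogeneousLatinBitrade k T T' ∧ T.card = k * m := by
  classical
  obtain ⟨q, rfl⟩ := hu
  obtain ⟨l, rfl⟩ := hdvd
  have hl : Even l := by
    rcases Nat.even_mul.1 hk with h | h
    · exact absurd h (by simp)
    · exact h
  obtain ⟨p, rfl⟩ := hl
  have hm' : (2 * p + 1) * (2 * q + 1) ≤ m := by nlinarith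
  have hq : (1 : ℤ) ≤ q := by omega
  haveI : NeZero m := ⟨by intro h; subst h; simp at hm'⟩
  let ι := Fin (2 * p) × Fin (2 * q + 1)
  have hcard : Fintype.card ι = (2 * q + 1) * (p + p) := by
    simp [ι]; ring
  let g : Fin (2 * q + 1) → ℤ := fun i => zf q (i : ℕ)
  let g' : Fin (2 * q + 1) → ℤ := fun i => 2 * q - zf q (2 * q - (i : ℕ))
  have bi : ∀ i : Fin (2 * q + 1), (0 : ℤ) ≤ (i : ℕ) ∧ ((i : ℕ) : ℤ) ≤ 2 * q := by
    intro i; have := i.2; omega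
  have bj : ∀ i : Fin (2 * p), (0 : ℤ) ≤ (i : ℕ) ∧ ((i : ℕ) : ℤ) ≤ 2 * p := by
    intro i; have := i.2; omega
  have frev : ∀ i : Fin (2 * q + 1), (((Fin.rev i : Fin _) : ℕ) : ℤ) = 2 * q - (i : ℕ) := by
    intro i; have := i.2; rw [Fin.val_rev]; omega
  have hgrev : ∀ i, g' i = 2 * q - g (Fin.rev i) := by
    intro i; simp only [g, g', frev]
  have fzb := fun j => zf_bd p _ (bj j).1 (bj j).2
  have gzb := fun j => zf_bd q _ (bi j).1 (bi j).2
  have gi : Function.Injective g := fun a b h => by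
    have := zf_inj _ _ _ h
    exact Fin.ext (by omega)
  have gai : Function.Injective (fun i : Fin (2 * q + 1) => ((i : ℕ) : ℤ) + g i) := fun a b h => by
    have := zf_add_inj _ _ _ (bi a).1 (bi a).2 (bi b).1 (bi b).2 h
    exact Fin.ext (by omega)
  have fi : Function.Injective (fun j : Fin (2 * p) => zf p (j : ℕ)) := fun a b h => by
    have := zf_inj _ _ _ h
    exact Fin.ext (by omega)
  have fai : Function.Injective (fun i : Fin (2 * p) => ((i : ℕ) : ℤ) + zf p (i : ℕ)) :=
    fun a b h => by
    have := zf_add_inj _ _ _ (bj a).1 (bj a).2 (bj b).1 (bj b).2 h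
    exact Fin.ext (by omega)
  have gi' : Function.Injective g' := fun a b h => by
    rw [hgrev, hgrev] at h
    exact Fin.rev_injective (gi (by linarith))
  have hsum : ∀ i : Fin (2 * q + 1), ((i : ℕ) : ℤ) + g' i
      = 4 * q - (((Fin.rev i : Fin _) : ℕ) + g (Fin.rev i)) := by
    intro i; rw [hgrev, frev]; ring
  have gai' : Function.Injective (fun i : Fin (2 * q + 1) => ((i : ℕ) : ℤ) + g' i) :=
    fun a b h => by
    simp only [hsum] at h
    exact Fin.rev_injective (gai (by simp only; linarith))
  have gb : ∀ i, 0 ≤ g i ∧ g i ≤ 0 + 2 * q := fun i => by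
    have := gzb i
    exact ⟨this.1, by linarith⟩
  have gab : ∀ i : Fin (2 * q + 1), (q : ℤ) ≤ (i : ℕ) + g i ∧ (i : ℕ) + g i ≤ (q : ℤ) + 2 * q :=
    fun i => by
    have := gzb i
    exact ⟨this.2.2.1, by linarith⟩
  have gb' : ∀ i, 0 ≤ g' i ∧ g' i ≤ 0 + 2 * q := fun i => by
    have := gb (Fin.rev i)
    rw [hgrev]
    constructor <;> linarith
  have gab' : ∀ i : Fin (2 * q + 1), (q : ℤ) ≤ (i : ℕ) + g' i ∧ (i : ℕ) + g' i ≤ (q : ℤ) + 2 * q :=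
    fun i => by
    have := gab (Fin.rev i)
    rw [hsum]
    constructor <;> linarith
  have fb : ∀ j : Fin (2 * p), 0 ≤ zf p (j : ℕ) ∧ zf p (j : ℕ) ≤ 0 + 2 * p := fun j => by
    have := fzb j
    exact ⟨this.1, by linarith⟩
  have fab : ∀ j : Fin (2 * p), (p : ℤ) ≤ (j : ℕ) + zf p (j : ℕ) ∧
      (j : ℕ) + zf p (j : ℕ) ≤ (p : ℤ) + 2 * p := fun j => by
    have := fzb j
    exact ⟨this.2.2.1, by linarith⟩
  have surj : ∀ (X Y : Fin (2 * q + 1) → ℤ) (B : ℤ), Function.Injective X →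
      (∀ i, B ≤ X i ∧ X i ≤ B + 2 * q) → (∀ i, B ≤ Y i ∧ Y i ≤ B + 2 * q) →
      ∀ i, ∃ j, X j = Y i := by
    intro X Y B hX hXb hYb i
    have him : Finset.univ.image X = Finset.Icc B (B + 2 * q) := by
      apply Finset.eq_of_subset_of_card_le
      · intro z hz
        obtain ⟨j, -, rfl⟩ := Finset.mem_image.1 hz
        exact Finset.mem_Icc.2 (hXb j)
      · rw [Finset.card_image_of_injective _ hX, Int.card_Icc, Finset.card_univ, Fintype.card_fin]
        omega
    have hy : Y i ∈ Finset.univ.image X := by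
      rw [him]; exact Finset.mem_Icc.2 (hYb i)
    obtain ⟨j, -, hj⟩ := Finset.mem_image.1 hy
    exact ⟨j, hj⟩
  let α : ι → ZMod m := fun t => (((2 * q + 1 : ℤ) * (t.1 : ℕ) + (t.2 : ℕ) : ℤ) : ZMod m)
  let β : ι → ZMod m := fun t => (((2 * q + 1 : ℤ) * ((t.1 : ℕ) + zf p (t.1 : ℕ))
    + ((t.2 : ℕ) + g t.2) : ℤ) : ZMod m)
  let β' : ι → ZMod m := fun t => (((2 * q + 1 : ℤ) * ((t.1 : ℕ) + zf p (t.1 : ℕ))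
    + ((t.2 : ℕ) + g' t.2) : ℤ) : ZMod m)
  have hdβ : ∀ t, β t - α t = (((2 * q + 1 : ℤ) * zf p (t.1 : ℕ) + g t.2 : ℤ) : ZMod m) := by
    intro t; simp only [α, β]; push_cast; ring
  have hdβ' : ∀ t, β' t - α t = (((2 * q + 1 : ℤ) * zf p (t.1 : ℕ) + g' t.2 : ℤ) : ZMod m) := by
    intro t; simp only [α, β']; push_cast; ring
  have hα : Function.Injective α :=
    cast_comb_inj hm' (fun j => ((j : ℕ) : ℤ)) (fun i => ((i : ℕ) : ℤ)) 0 0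
      (fun j => by have := bj j; omega) (fun j => by have := bi j; omega)
      (fun a b h => Fin.ext (by simp only at h; omega))
      (fun a b h => Fin.ext (by simp only at h; omega))
  have hβ : Function.Injective β := cast_comb_inj hm' _ _ p q fab gab fai gai
  have hβ' : Function.Injective β' := cast_comb_inj hm' _ _ p q fab gab' fai gai'
  have hd : Function.Injective (fun t => β t - α t) := by
    simp only [hdβ]; exact cast_comb_inj hm' _ _ 0 0 fb gb fi gi
  have hd' : Function.Injective (fun t => β' t - α t) := by
    simp only [hdβ']; exact cast_comb_inj hm' _ _ 0 0 fb gb' fi gi'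
  refine ⟨cycT α β, cycT α β', ?_, ?_⟩
  · rw [← hcard]
    refine cycT_bitrade α β β' hα hβ hβ' hd hd' ?_ ?_ ?_ ?_ ?_
    · rintro ⟨j, i⟩ h
      have hmz : ((2 * q + 1 : ℤ)) ≤ m := by
        have : 2 * q + 1 ≤ m := by nlinarith
        exact_mod_cast this
      have h' : ((g i : ℤ) : ZMod m) = ((g' i : ℤ) : ZMod m) := by
        simp only [β, β'] at h
        push_cast at h
        linear_combination h
      have b1 := gb i
      have b2 := gb' i
      have := cast_inj_win m 0 _ _ b1.1 (by linarith) b2.1 (by linarith) h'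
      exact zf_ne q _ hq this
    · rintro ⟨j, i⟩
      obtain ⟨i', h⟩ := surj _ _ q gai' gab' gab i
      exact ⟨(j, i'), by simp only [β, β']; rw [h]⟩
    · rintro ⟨j, i⟩
      obtain ⟨i', h⟩ := surj _ _ q gai gab gab' i
      exact ⟨(j, i'), by simp only [β, β']; rw [h]⟩
    · rintro ⟨j, i⟩
      obtain ⟨i', h⟩ := surj _ _ 0 gi' gb' gb i
      exact ⟨(j, i'), by rw [hdβ, hdβ']; simp only; rw [h]⟩
    · rintro ⟨j, i⟩
      obtain ⟨i', h⟩ := surj _ _ 0 gi gb gb' i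
      exact ⟨(j, i'), by rw [hdβ, hdβ']; simp only; rw [h]⟩
  · rw [cycT_card α β hα, hcard]
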